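/- arXiv:2602.18337 — 4 statements merged into one kernel-verified Lean document; each statement's English description precedes it below -/
import Mathlib

section
/- Let (Ω, 𝓕, μ) be a probability space, q > 1 a real number, and f : Ω → ℝ a measurable function with |f| ≤ C almost everywhere for some constant C > 0, satisfying ∫_Ω f dμ = 0. Define ψ(t) = (∫_Ω |1+tf|^{q+1} dμ)^{2/(q+1)}. Then ψ is twice differentiable at t = 0, ψ'(0) = 0, and (1/2)·ψ''(0) = q·∫_Ω f² dμ. -/
open MeasureTheory

/-- Differentiation under the integral sign for `t ↦ ∫ g |1 + t f|^p`, in the range of `t` where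
`1 + t f` stays away from `0`. -/
theorem hasDerivAt_integral_mul_abs_one_add_mul_rpow {Ω : Type*} [MeasurableSpace Ω]
    {μ : Measure Ω} [IsFiniteMeasure μ] {p : ℝ} (hp : 1 ≤ p) {f g : Ω → ℝ} (hf : Measurable f)
    (hg : Measurable g) {C D : ℝ} (hC : 0 < C) (hfC : ∀ᵐ ω ∂μ, |f ω| ≤ C)
    (hgD : ∀ᵐ ω ∂μ, |g ω| ≤ D) {t : ℝ} (ht : |t| < 1 / C) :
    HasDerivAt (fun t => ∫ ω, g ω * |1 + t * f ω| ^ p ∂μ)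
      (∫ ω, p * g ω * f ω * |1 + t * f ω| ^ (p - 1) ∂μ) t := by
  have hsmall : ∀ {x : ℝ} {ω : Ω}, |x| < 1 / C → |f ω| ≤ C → |x * f ω| < 1 := by
    intro x ω hx hω
    rw [abs_mul]
    calc |x| * |f ω| ≤ |x| * C := by gcongr
      _ < 1 := (lt_div_iff₀ hC).1 hx
  have habs_le : ∀ {x : ℝ} {ω : Ω}, |x| < 1 / C → |f ω| ≤ C → |1 + x * f ω| ≤ 2 := by
    intro x ω hx hω
    have h := abs_lt.1 (hsmall hx hω)
    exact abs_le.2 ⟨by linarith, by linarith⟩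
  have hp' : 0 ≤ p - 1 := sub_nonneg.2 hp
  have hmeas : ∀ x : ℝ, Measurable fun ω => g ω * |1 + x * f ω| ^ p := fun x => by
    fun_prop
  refine (hasDerivAt_integral_of_dominated_loc_of_deriv_le (s := {x | |x| < 1 / C})
    (bound := fun _ => p * D * C * 2 ^ (p - 1))
    (F' := fun x ω => p * g ω * f ω * |1 + x * f ω| ^ (p - 1))
    ((isOpen_lt continuous_abs continuous_const).mem_nhds ht)
    (.of_forall fun x => (hmeas x).aestronglyMeasurable) ?_ ?_ ?_ (integrable_const _) ?_).2
  · refine Integrable.of_bound (hmeas t).aestronglyMeasurable (D * 2 ^ p) ?_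
    filter_upwards [hfC, hgD] with ω hω hω'
    rw [Real.norm_eq_abs, abs_mul, abs_of_nonneg (Real.rpow_nonneg (abs_nonneg _) p)]
    have hD : 0 ≤ D := (abs_nonneg _).trans hω'
    gcongr
    exact habs_le ht hω
  · have : Measurable fun ω => p * g ω * f ω * |1 + t * f ω| ^ (p - 1) := by fun_prop
    exact this.aestronglyMeasurable
  · filter_upwards [hfC, hgD] with ω hω hω' x hx
    rw [Real.norm_eq_abs, abs_mul, abs_mul, abs_mul, abs_of_nonneg (by linarith : 0 ≤ p),
      abs_of_nonneg (Real.rpow_nonneg (abs_nonneg _) (p - 1))]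
    have hD : 0 ≤ D := (abs_nonneg _).trans hω'
    gcongr
    exact habs_le hx hω
  · filter_upwards [hfC] with ω hω x hx
    have hpos : 0 < 1 + x * f ω := by linarith [(abs_lt.1 (hsmall hx hω)).1]
    have hlin : HasDerivAt (fun y => 1 + y * f ω) (f ω) x := by
      simpa using ((hasDerivAt_id x).mul_const (f ω)).const_add 1
    have habs : HasDerivAt (fun y => |1 + y * f ω|) (f ω) x := by
      refine hlin.congr_of_eventuallyEq ?_
      filter_upwards [hlin.continuousAt.eventually (lt_mem_nhds hpos)] with y hy
      exact abs_of_pos hy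
    exact ((habs.rpow_const (p := p) (Or.inr hp)).const_mul (g ω)).congr_deriv (by ring)

/-- On a probability space, for `q > 1` and a measurable `f` with `|f| ≤ C` a.e. (`C > 0`)
and `∫ f = 0`, the function `ψ t = (∫ |1 + t f|^(q+1))^(2/(q+1))` is twice differentiable
at `t = 0`, with `ψ'(0) = 0` and `(1/2) ψ''(0) = q ∫ f²`. -/
theorem stmt_1 {Ω : Type*} [MeasurableSpace Ω] (μ : Measure Ω) [IsProbabilityMeasure μ]
    (q : ℝ) (hq : 1 < q) (f : Ω → ℝ) (hf : Measurable f) (C : ℝ) (hC : 0 < C)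
    (hbd : ∀ᵐ ω ∂μ, |f ω| ≤ C) (hmean : ∫ ω, f ω ∂μ = 0) (ψ : ℝ → ℝ)
    (hψ : ∀ t : ℝ, ψ t = (∫ ω, |1 + t * f ω| ^ (q + 1) ∂μ) ^ (2 / (q + 1))) :
    DifferentiableAt ℝ ψ 0 ∧ DifferentiableAt ℝ (deriv ψ) 0 ∧
      deriv ψ 0 = 0 ∧ (1 / 2) * deriv (deriv ψ) 0 = q * ∫ ω, (f ω) ^ 2 ∂μ := by
  have hq1 : q + 1 ≠ 0 := by linarith
  set a := 2 / (q + 1) with ha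
  set I : ℝ → ℝ := fun t => ∫ ω, |1 + t * f ω| ^ (q + 1) ∂μ with hI
  set J : ℝ → ℝ := fun t => ∫ ω, (q + 1) * f ω * |1 + t * f ω| ^ q ∂μ with hJ
  obtain rfl : ψ = fun t => I t ^ a := funext hψ
  have hI' : ∀ {t}, |t| < 1 / C → HasDerivAt I (J t) t := fun {t} ht => by
    simpa [hI, hJ] using hasDerivAt_integral_mul_abs_one_add_mul_rpow (p := q + 1) (by linarith)
      hf (measurable_const (a := (1 : ℝ))) hC hbd (D := 1) (by simp) ht
  have h0 : |(0 : ℝ)| < 1 / C := by simpa using hC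
  have hJ' : HasDerivAt J ((q + 1) * q * ∫ ω, f ω ^ 2 ∂μ) 0 := by
    have hgD : ∀ᵐ ω ∂μ, |(q + 1) * f ω| ≤ (q + 1) * C := by
      filter_upwards [hbd] with ω hω
      rw [abs_mul, abs_of_pos (by linarith : 0 < q + 1)]
      gcongr
    convert hasDerivAt_integral_mul_abs_one_add_mul_rpow hq.le hf (hf.const_mul (q + 1)) hC hbd
      hgD h0 using 1
    rw [← integral_const_mul]
    congr with ω
    simp
    ring
  have hI0 : I 0 = 1 := by simp [hI]
  have hJ0 : J 0 = 0 := by simp [hJ, integral_const_mul, hmean]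
  have hψ' : ∀ᶠ t in nhds 0, HasDerivAt (fun t => I t ^ a) (J t * a * I t ^ (a - 1)) t := by
    filter_upwards [(isOpen_lt continuous_abs continuous_const).mem_nhds h0,
      (hI' h0).continuousAt.eventually_ne (by simp [hI0] : I 0 ≠ 0)] with t ht hIt
    exact (hI' ht).rpow_const (Or.inl hIt)
  have hψ'' : HasDerivAt (deriv fun t => I t ^ a) (2 * (q * ∫ ω, f ω ^ 2 ∂μ)) 0 := by
    refine HasDerivAt.congr_of_eventuallyEq ?_ (hψ'.mono fun t ht => ht.deriv)
    refine ((hJ'.mul_const a).mul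
      ((hI' h0).rpow_const (p := a - 1) (Or.inl (by simp [hI0])))).congr_deriv ?_
    simp only [hI0, hJ0, Real.one_rpow, ha]
    field_simp
    ring
  refine ⟨hψ'.self_of_nhds.differentiableAt, hψ''.differentiableAt, ?_, ?_⟩
  · simp [hψ'.self_of_nhds.deriv, hJ0]
  · rw [hψ''.deriv]
    ring
end

section
/- Let γ > 0, a > 0, β ≠ 0, λ > 0 and q > 1 be real numbers. Define A₁ = γ(γ−1) − 2a(γ−1) + a² + (3γ−4a)(β+1) + (2 − 2a/γ)(β+1)², B₁ = (3γ−4a)/β + (2 − 2a/γ)(q − γ/β), C₁ = ((4a−3γ)/β + (2 − 2a/γ)(γ−β)/β)·λ − 1, and D₁ = 2a/γ − 1. Then it is not the case that A₁ ≤ 0, B₁ ≤ 0, C₁ ≤ 0 and D₁ ≤ 0 all hold simultaneously. -/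
/-- For `γ > 0`, `a > 0`, `β ≠ 0`, `λ > 0`, `q > 1`, the coefficients
`A₁ = γ(γ−1) − 2a(γ−1) + a² + (3γ−4a)(β+1) + (2 − 2a/γ)(β+1)²`,
`B₁ = (3γ−4a)/β + (2 − 2a/γ)(q − γ/β)`,
`C₁ = ((4a−3γ)/β + (2 − 2a/γ)(γ−β)/β)·λ − 1`, and
`D₁ = 2a/γ − 1` cannot all be nonpositive simultaneously. -/
theorem stmt_3 (γ a β lam q : ℝ) (hγ : 0 < γ) (ha : 0 < a) (hβ : β ≠ 0)
    (hlam : 0 < lam) (hq : 1 < q) :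
    ¬ (γ * (γ - 1) - 2 * a * (γ - 1) + a ^ 2 + (3 * γ - 4 * a) * (β + 1)
        + (2 - 2 * a / γ) * (β + 1) ^ 2 ≤ 0 ∧
      (3 * γ - 4 * a) / β + (2 - 2 * a / γ) * (q - γ / β) ≤ 0 ∧
      ((4 * a - 3 * γ) / β + (2 - 2 * a / γ) * ((γ - β) / β)) * lam - 1 ≤ 0 ∧
      2 * a / γ - 1 ≤ 0) := by
  rintro ⟨hA, hB, -, hD⟩
  obtain ⟨u, rfl⟩ : ∃ u, a = γ * (1 - u) := ⟨1 - a / γ, by field_simp; ring⟩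
  have hdiv : 2 * (γ * (1 - u)) / γ = 2 * (1 - u) := by field_simp
  rw [hdiv] at hA hB hD
  have hu : 0 < u := by linarith
  have hu1 : 0 < 1 - u := pos_of_mul_pos_right ha hγ.le
  have hB' : γ * (2 * u - 1) / β + 2 * u * q ≤ 0 := by
    convert hB using 1
    field_simp
    ring
  have hβneg : β < 0 := by
    by_contra! hβ0
    have : 0 ≤ γ * (2 * u - 1) / β :=
      div_nonneg (mul_nonneg hγ.le (by linarith)) hβ0
    nlinarith [mul_pos hu (by linarith : 0 < q)]
  have hd : 0 ≤ γ * (2 * u - 1) + 2 * u * β := by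
    have hq' : γ * (2 * u - 1) / β ≤ -(2 * u * q) := by linarith
    rw [div_le_iff_of_neg hβneg] at hq'
    nlinarith [mul_pos (mul_pos hu (neg_pos.2 hβneg)) (sub_pos.2 hq)]
  have hpos : 0 < 2 * u * (γ ^ 2 * (1 - u) ^ 2 + 2 * γ * (1 - u) + 2 * u)
      + (γ * (2 * u - 1) + 2 * u * β)
        * (γ + 4 * u + (γ * (2 * u - 1) + 2 * u * β)) := by
    positivity
  nlinarith [mul_nonneg hu.le (neg_nonneg.2 hA)]
end

section
/- Let γ > 0, a ≤ 0, β ≠ 0, λ ≥ 0 and q > 1 be real numbers. Define B₁ = (3γ−4a)/β + (2 − 2a/γ)(q − γ/β) and C₁ = ((4a−3γ)/β + (2 − 2a/γ)(γ−β)/β)·λ − 1. If B₁ ≤ 0 and C₁ ≤ 0, then λ ≤ 1/(2(q−1)). -/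
/-- For `γ > 0`, `a ≤ 0`, `β ≠ 0`, `λ ≥ 0`, `q > 1`: if
`B₁ = (3γ−4a)/β + (2 − 2a/γ)(q − γ/β) ≤ 0` and
`C₁ = ((4a−3γ)/β + (2 − 2a/γ)(γ−β)/β)·λ − 1 ≤ 0`, then `λ ≤ 1/(2(q−1))`. -/
theorem stmt_4 (γ a β lam q : ℝ) (hγ : 0 < γ) (ha : a ≤ 0) (hβ : β ≠ 0)
    (hlam : 0 ≤ lam) (hq : 1 < q)
    (hB : (3 * γ - 4 * a) / β + (2 - 2 * a / γ) * (q - γ / β) ≤ 0)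
    (hC : ((4 * a - 3 * γ) / β + (2 - 2 * a / γ) * ((γ - β) / β)) * lam - 1 ≤ 0) :
    lam ≤ 1 / (2 * (q - 1)) := by
  have hk : 2 ≤ 2 - 2 * a / γ := by
    have : 2 * a / γ ≤ 0 := div_nonpos_of_nonpos_of_nonneg (by linarith) hγ.le
    linarith
  have hcoeff : 2 * (q - 1) ≤ (4 * a - 3 * γ) / β + (2 - 2 * a / γ) * ((γ - β) / β) := by
    have hneg : (4 * a - 3 * γ) / β = -((3 * γ - 4 * a) / β) := by ring
    rw [hneg, sub_div γ β β, div_self hβ]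
    have : 2 * (q - 1) ≤ (2 - 2 * a / γ) * (q - 1) :=
      mul_le_mul_of_nonneg_right hk (by linarith)
    linarith
  rw [le_div_iff₀ (by linarith)]
  have := mul_le_mul_of_nonneg_right hcoeff hlam
  linarith
end

section
/- Let n ≥ 2 be an integer and let q, ε be real numbers with 1 < q < (n+1)/(n−1) and ε ≥ 0. Then there exists a real number k > 0 satisfying n(n−1)q·k² + k·(q(2n² + n(n−1)ε − 2n) − 4n² − 4n) + qε(n−1)² + qn(n−1) ≤ 0 if and only if ε ≤ (4n(n+1) − 2q(n−1) − 2(n−1)·√(q² + 4qn(n+1)))/(n(n−1)q). -/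
/-- A real quadratic with positive leading and constant coefficients takes a nonpositive value at
some positive point iff its linear coefficient is negative and its discriminant nonnegative. -/
theorem exists_pos_quadratic_nonpos_iff {a b c : ℝ} (ha : 0 < a) (hc : 0 < c) :
    (∃ k : ℝ, 0 < k ∧ a * k ^ 2 + b * k + c ≤ 0) ↔ b < 0 ∧ 4 * a * c ≤ b ^ 2 := by
  constructor
  · rintro ⟨k, hk, h⟩
    constructor
    · by_contra! hb
      have : 0 < a * k ^ 2 + b * k + c := by positivity
      linarith
    · nlinarith [sq_nonneg (2 * a * k + b), mul_nonneg ha.le (neg_nonneg.2 h)]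
  · rintro ⟨hb, hd⟩
    refine ⟨-b / (2 * a), div_pos (by linarith) (by linarith), ?_⟩
    have key : a * (-b / (2 * a)) ^ 2 + b * (-b / (2 * a)) + c
        = (4 * a * c - b ^ 2) / (4 * a) := by
      field_simp
      ring
    rw [key]
    exact div_nonpos_of_nonpos_of_nonneg (by linarith) (by linarith)

/-- For an integer `n ≥ 2` and reals `1 < q < (n+1)/(n−1)`, `ε ≥ 0`, there exists `k > 0` with
`n(n−1)q k² + k(q(2n² + n(n−1)ε − 2n) − 4n² − 4n) + qε(n−1)² + qn(n−1) ≤ 0`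
iff `ε ≤ (4n(n+1) − 2q(n−1) − 2(n−1)√(q² + 4qn(n+1)))/(n(n−1)q)`. -/
theorem stmt_7 (n : ℕ) (hn : 2 ≤ n) (q ε : ℝ) (hq1 : 1 < q)
    (hq2 : q < ((n : ℝ) + 1) / ((n : ℝ) - 1)) (hε : 0 ≤ ε) :
    (∃ k : ℝ, 0 < k ∧
      (n : ℝ) * ((n : ℝ) - 1) * q * k ^ 2
        + k * (q * (2 * (n : ℝ) ^ 2 + (n : ℝ) * ((n : ℝ) - 1) * ε - 2 * (n : ℝ))
            - 4 * (n : ℝ) ^ 2 - 4 * (n : ℝ))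
        + q * ε * ((n : ℝ) - 1) ^ 2 + q * (n : ℝ) * ((n : ℝ) - 1) ≤ 0) ↔
    ε ≤ (4 * (n : ℝ) * ((n : ℝ) + 1) - 2 * q * ((n : ℝ) - 1)
          - 2 * ((n : ℝ) - 1) * Real.sqrt (q ^ 2 + 4 * q * (n : ℝ) * ((n : ℝ) + 1)))
        / ((n : ℝ) * ((n : ℝ) - 1) * q) := by
  have hN : (2 : ℝ) ≤ n := by exact_mod_cast hn
  generalize (n : ℝ) = N at *
  have hm : 0 < N - 1 := by linarith
  have hN0 : 0 < N := by linarith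
  have hq : 0 < q := by linarith
  have ha : 0 < N * (N - 1) * q := by positivity
  have hc : 0 < q * ε * (N - 1) ^ 2 + q * N * (N - 1) := by positivity
  have hqm : q * (N - 1) < N + 1 := (lt_div_iff₀ hm).1 hq2
  have hquad := exists_pos_quadratic_nonpos_iff
    (b := q * (2 * N ^ 2 + N * (N - 1) * ε - 2 * N) - 4 * N ^ 2 - 4 * N) ha hc
  have hS2 : √(q ^ 2 + 4 * q * N * (N + 1)) ^ 2 = q ^ 2 + 4 * q * N * (N + 1) :=
    Real.sq_sqrt (by positivity)
  have hS : q * (N - 1) < √(q ^ 2 + 4 * q * N * (N + 1)) := by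
    apply Real.lt_sqrt_of_sq_lt
    nlinarith [mul_lt_mul_of_pos_left hqm (mul_pos hq hm), mul_pos hq hN0, sq_nonneg q,
      mul_pos (mul_pos hq hN0) hN0]
  generalize √(q ^ 2 + 4 * q * N * (N + 1)) = S at *
  have hmS : (N - 1) * (q * (N - 1)) < (N - 1) * S := mul_lt_mul_of_pos_left hS hm
  have hmq : 0 < (N - 1) * (q * (N - 1)) := by positivity
  -- The discriminant factors over its two roots in `ε`, up to scaling.
  have hdisc : (q * (2 * N ^ 2 + N * (N - 1) * ε - 2 * N) - 4 * N ^ 2 - 4 * N) ^ 2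
        - 4 * (N * (N - 1) * q) * (q * ε * (N - 1) ^ 2 + q * N * (N - 1))
      = (4 * N * (N + 1) - 2 * q * (N - 1) - 2 * (N - 1) * S - ε * (N * (N - 1) * q))
        * (4 * N * (N + 1) - 2 * q * (N - 1) + 2 * (N - 1) * S - ε * (N * (N - 1) * q)) := by
    linear_combination 4 * (N - 1) ^ 2 * hS2
  rw [le_div_iff₀ ha]
  refine Iff.trans (exists_congr fun k => and_congr_right fun _ => ?_) (hquad.trans ?_)
  · rw [← sub_nonneg, ← sub_nonneg (b := _ + _ + (_ + _))]
    ring_nf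
  · constructor
    · rintro ⟨hb, hd⟩
      have hpos : 0 < 4 * N * (N + 1) - 2 * q * (N - 1) + 2 * (N - 1) * S
          - ε * (N * (N - 1) * q) := by nlinarith
      have := nonneg_of_mul_nonneg_left (hdisc ▸ sub_nonneg.2 hd) hpos
      linarith
    · intro h
      refine ⟨by nlinarith, ?_⟩
      rw [← sub_nonneg, hdisc]
      exact mul_nonneg (by linarith) (by nlinarith)
end
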